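/- Let ξ = (Γ, B, ν̄, c₁,…,c_b, c₁′,…,c_b′, α₁,…,α_k) be theta data. Then for every τ in the upper half plane ℍ, the family indexed by ν ∈ ν̄ + Γ with terms ∏_{i=1}^{b}(sgn(B(c_i,ν)) − sgn(B(c_i′,ν))) · ∏_{j=1}^{k} B(α_j,ν) · e^{2πi Q(ν) τ} is absolutely summable; in particular the series Θ_ξ(τ) converges absolutely. -/

import Mathlib

open scoped BigOperators

/-- The ℚ-bilinear pairing on `Fin n → ℚ` induced by an integer matrix,
representing a symmetric bilinear form `B : Γ × Γ → ℤ` on the finitely generated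
free abelian group `Γ = ℤ^n`, extended ℚ-bilinearly to `Γ ⊗ ℚ = ℚ^n`. -/
def intPair {n : ℕ} (M : Matrix (Fin n) (Fin n) ℤ) (x y : Fin n → ℚ) : ℚ :=
  ∑ i, ∑ j, (M i j : ℚ) * x i * y j

/-- The sign function: `sgn x = x / |x|` for `x ≠ 0` and `sgn 0 = 0`. -/
def sgn (x : ℚ) : ℚ := if 0 < x then 1 else if x < 0 then -1 else 0

/-- Raw theta data `ξ = (Γ, B, ν̄, c₁,…,c_b, c₁′,…,c_b′, α₁,…,α_k)`, with
`Γ = ℤ^n` and `B` given by the integer matrix `M`. -/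
structure ThetaData where
  n : ℕ
  b : ℕ
  k : ℕ
  M : Matrix (Fin n) (Fin n) ℤ
  c : Fin b → Fin n → ℚ
  c' : Fin b → Fin n → ℚ
  nubar : Fin n → ℚ
  alpha : Fin k → Fin n → ℚ

namespace ThetaData

/-- The element `ν̄ + g` of the coset `ν̄ + Γ ⊆ Γ ⊗ ℚ`. -/
def nu (ξ : ThetaData) (g : Fin ξ.n → ℤ) : Fin ξ.n → ℚ :=
  ξ.nubar + fun t => (g t : ℚ)

/-- Conditions (i)–(v) on theta data:
(i) `B` is a non-degenerate symmetric bilinear form whose real (equivalently,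
rational) extension has signature `(a, b)` with `a = n - b ≥ b` (expressed by
non-degeneracy together with a positive definite subspace of dimension `n - b`,
and the negative definite `b`-dimensional subspace from (ii));
(ii) `c₁,…,c_b` span a `b`-dimensional negative definite subspace;
(iii) the orthogonality conditions on `c_i, c_j′`;
(iv) `B(c_i′, ν) ≠ 0` for all `ν ∈ ν̄ + Γ`;
(v) is automatic. -/
def IsThetaData (ξ : ThetaData) : Prop :=
  2 * ξ.b ≤ ξ.n ∧
  ξ.M.IsSymm ∧
  (∀ x : Fin ξ.n → ℚ, (∀ y, intPair ξ.M x y = 0) → x = 0) ∧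
  (∃ P : Submodule ℚ (Fin ξ.n → ℚ), Module.finrank ℚ P = ξ.n - ξ.b ∧
    ∀ v ∈ P, v ≠ 0 → 0 < intPair ξ.M v v) ∧
  Module.finrank ℚ (Submodule.span ℚ (Set.range ξ.c)) = ξ.b ∧
  (∀ v ∈ Submodule.span ℚ (Set.range ξ.c), v ≠ 0 → intPair ξ.M v v < 0) ∧
  (∀ i j, i ≠ j → intPair ξ.M (ξ.c i) (ξ.c' j) = 0) ∧
  (∀ i j, intPair ξ.M (ξ.c' i) (ξ.c' j) = 0) ∧
  (∀ i, intPair ξ.M (ξ.c i) (ξ.c' i) < 0) ∧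
  (∀ i (g : Fin ξ.n → ℤ), intPair ξ.M (ξ.c' i) (ξ.nu g) ≠ 0)

/-- The term of the theta series `Θ_ξ` indexed by `ν = ν̄ + g ∈ ν̄ + Γ`:
`∏_{i=1}^{b} (sgn(B(c_i,ν)) − sgn(B(c_i′,ν))) ∏_{j=1}^{k} B(α_j,ν) e^{2πi Q(ν) τ}`,
where `Q(ν) = B(ν,ν)/2`. -/
noncomputable def term (ξ : ThetaData) (τ : ℂ) (g : Fin ξ.n → ℤ) : ℂ :=
  (((∏ i, (sgn (intPair ξ.M (ξ.c i) (ξ.nu g)) - sgn (intPair ξ.M (ξ.c' i) (ξ.nu g)))) *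
      ∏ j, intPair ξ.M (ξ.alpha j) (ξ.nu g) : ℚ) : ℂ) *
    Complex.exp (2 * (Real.pi : ℂ) * Complex.I *
      ((intPair ξ.M (ξ.nu g) (ξ.nu g) / 2 : ℚ) : ℂ) * τ)

/-- The theta series `Θ_ξ(τ)`. -/
noncomputable def Theta (ξ : ThetaData) (τ : ℂ) : ℂ :=
  ∑' g : Fin ξ.n → ℤ, ξ.term τ g

end ThetaData

/-- A vector orthogonal to a maximal negative definite subspace has positive norm. -/
theorem LinearMap.BilinForm.apply_self_pos_of_orthogonal {V : Type*} [AddCommGroup V] [Module ℚ V]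
    [FiniteDimensional ℚ V] (B : LinearMap.BilinForm ℚ V) (hB : ∀ x y, B x y = B y x)
    (P C : Submodule ℚ V)
    (hdim : Module.finrank ℚ V ≤ Module.finrank ℚ P + Module.finrank ℚ C)
    (hP : ∀ v ∈ P, v ≠ 0 → 0 < B v v) (hC : ∀ v ∈ C, v ≠ 0 → B v v < 0)
    (w : V) (hw : ∀ v ∈ C, B v w = 0) (hw0 : w ≠ 0) : 0 < B w w := by
  by_contra! hneg
  have hwC : w ∉ C := fun h => (hC w h hw0).ne (hw w h)
  have hdisj : Disjoint C (Submodule.span ℚ {w}) := by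
    rw [Submodule.disjoint_span_singleton' hw0]
    exact hwC
  have hdisjP : Disjoint P (C ⊔ Submodule.span ℚ {w}) := by
    rw [Submodule.disjoint_def]
    intro v hvP hv
    obtain ⟨u, hu, z, hz, rfl⟩ := Submodule.mem_sup.mp hv
    obtain ⟨r, rfl⟩ := Submodule.mem_span_singleton.mp hz
    by_contra h0
    have hpos := hP _ hvP h0
    have hexp : B (u + r • w) (u + r • w) = B u u + r ^ 2 * B w w := by
      simp only [map_add, map_smul, LinearMap.add_apply, LinearMap.smul_apply, smul_eq_mul,
        hB w u, hw u hu]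
      ring
    have hu' : B u u ≤ 0 := by
      rcases eq_or_ne u 0 with rfl | hu0
      · simp
      · exact (hC u hu hu0).le
    nlinarith [mul_nonneg (sq_nonneg r) (neg_nonneg.mpr hneg)]
  have h1 := Submodule.finrank_add_finrank_le_of_disjoint hdisjP
  have h2 := Submodule.finrank_sup_add_finrank_inf_eq C (Submodule.span ℚ {w})
  rw [hdisj.eq_bot, finrank_bot, finrank_span_singleton hw0] at h2
  omega

/-- A linear functional is bounded with respect to a positive definite form. -/
theorem LinearMap.BilinForm.exists_sq_le_of_posDef {V : Type*} [AddCommGroup V] [Module ℚ V]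
    [FiniteDimensional ℚ V] (F : LinearMap.BilinForm ℚ V) (hF : ∀ x y, F x y = F y x)
    (hpos : ∀ v, v ≠ 0 → 0 < F v v) (l : V →ₗ[ℚ] ℚ) :
    ∃ K : ℚ, 0 ≤ K ∧ ∀ v, l v ^ 2 ≤ K * F v v := by
  have hnn : ∀ v, 0 ≤ F v v := fun v => by
    rcases eq_or_ne v 0 with rfl | h
    · simp
    · exact (hpos v h).le
  have hinj : Function.Injective F := by
    rw [← LinearMap.ker_eq_bot, LinearMap.ker_eq_bot']
    intro v hv
    by_contra h
    exact (hpos v h).ne' (by simp [hv])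
  obtain ⟨u, rfl⟩ := (LinearMap.injective_iff_surjective_of_finrank_eq_finrank
    (Subspace.dual_finrank_eq (K := ℚ) (V := V)).symm).mp hinj l
  exact ⟨F u u, hnn u, fun v => F.apply_sq_le_of_symm hnn ⟨hF⟩ u v⟩

/-- On the cone cut out by `c` and `c'`, away from the walls of the isotropic vectors `c'`, the
quadratic form is nonnegative and every linear functional grows at most linearly in it. -/
theorem LinearMap.BilinForm.exists_abs_le_on_cone {V : Type*} [AddCommGroup V] [Module ℚ V]
    [FiniteDimensional ℚ V] {b : ℕ} (B : LinearMap.BilinForm ℚ V) (hB : ∀ x y, B x y = B y x)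
    (c c' : Fin b → V)
    (hC : ∀ v ∈ Submodule.span ℚ (Set.range c), v ≠ 0 → B v v < 0)
    (hperp : ∀ w, (∀ i, B (c i) w = 0) → w ≠ 0 → 0 < B w w)
    (hcross : ∀ i j, i ≠ j → B (c i) (c' j) = 0) (hisotropic : ∀ i j, B (c' i) (c' j) = 0)
    (hd : ∀ i, B (c i) (c' i) < 0) (ε : ℚ) (hε : 0 < ε) (l : V →ₗ[ℚ] ℚ) :
    ∃ K : ℚ, 0 ≤ K ∧ ∀ v, (∀ i, B (c i) v * B (c' i) v ≤ 0) → (∀ i, ε ≤ |B (c' i) v|) →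
      0 ≤ B v v ∧ |l v| ≤ K * (1 + B v v) := by
  let d : Fin b → ℚ := fun i => B (c i) (c' i)
  have hd0 : ∀ i, d i ≠ 0 := fun i => (hd i).ne
  let L : V →ₗ[ℚ] V := ∑ i, ((d i)⁻¹ • B (c' i)).smulRight (c i)
  let R : V →ₗ[ℚ] V := ∑ i, ((d i)⁻¹ • (B (c i) - (B (c i)).comp L)).smulRight (c' i)
  let W : V →ₗ[ℚ] V := LinearMap.id - L - R
  have hL : ∀ v, L v = ∑ i, ((d i)⁻¹ * B (c' i) v) • c i := fun v => by simp [L]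
  have hR : ∀ v, R v = ∑ i, ((d i)⁻¹ * (B (c i) v - B (c i) (L v))) • c' i := fun v => by
    simp [R]
  have hW : ∀ v, v = W v + L v + R v := fun v => by
    simp only [W, LinearMap.sub_apply, LinearMap.id_apply]
    abel
  have hcR : ∀ i v, B (c i) (R v) = B (c i) v - B (c i) (L v) := by
    intro i v
    rw [hR, map_sum, Finset.sum_eq_single i]
    · rw [map_smul, smul_eq_mul, mul_right_comm, inv_mul_cancel₀ (hd0 i), one_mul]
    · intro j _ hj
      simp [hcross i j hj.symm]
    · simp
  have hprimeL : ∀ i v, B (c' i) (L v) = B (c' i) v := by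
    intro i v
    rw [hL, map_sum, Finset.sum_eq_single i]
    · rw [map_smul, smul_eq_mul, hB (c' i) (c i), mul_right_comm, inv_mul_cancel₀ (hd0 i),
        one_mul]
    · intro j _ hj
      simp [hB (c' i) (c j), hcross j i hj]
    · simp
  have hprimeR : ∀ i v, B (c' i) (R v) = 0 := fun i v => by simp [hR, hisotropic]
  have hcW : ∀ i v, B (c i) (W v) = 0 := fun i v => by simp [W, hcR]
  have hprimeW : ∀ i v, B (c' i) (W v) = 0 := fun i v => by simp [W, hprimeR, hprimeL]
  have hLmem : ∀ v, L v ∈ Submodule.span ℚ (Set.range c) := fun v => by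
    rw [hL]
    exact Submodule.sum_mem _ fun i _ => Submodule.smul_mem _ _ (Submodule.subset_span ⟨i, rfl⟩)
  have hLW : ∀ v, B (L v) (W v) = 0 := fun v => by
    rw [hL, map_sum, LinearMap.sum_apply]
    simp [hcW]
  have hRW : ∀ v, B (R v) (W v) = 0 := fun v => by
    rw [hR, map_sum, LinearMap.sum_apply]
    simp [hprimeW]
  have hRR : ∀ v, B (R v) (R v) = 0 := fun v => by
    nth_rewrite 1 [hR]
    rw [map_sum, LinearMap.sum_apply]
    simp [hprimeR]
  have hLR : ∀ v, B (L v) (R v) =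
      ∑ i, (d i)⁻¹ * B (c' i) v * B (c i) v - B (L v) (L v) := fun v => by
    have h : ∀ u, B (L v) u = ∑ i, (d i)⁻¹ * B (c' i) v * B (c i) u := fun u => by
      rw [hL, map_sum, LinearMap.sum_apply]
      simp
    rw [h, h, ← Finset.sum_sub_distrib]
    exact Finset.sum_congr rfl fun i _ => by rw [hcR]; ring
  have hBvv : ∀ v, B v v = B (W v) (W v) - B (L v) (L v)
      + 2 * ∑ i, (d i)⁻¹ * B (c' i) v * B (c i) v := fun v => by
    have h : B v v = B (W v + L v + R v) (W v + L v + R v) := by rw [← hW v]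
    rw [h]
    simp only [map_add, LinearMap.add_apply, hB (W v) (L v), hB (W v) (R v), hB (R v) (L v),
      hLW, hRW, hRR, hLR]
    ring
  have hWnn : ∀ v, 0 ≤ B (W v) (W v) := fun v => by
    rcases eq_or_ne (W v) 0 with h | h
    · simp [h]
    · exact (hperp _ (fun i => hcW i v) h).le
  have hLnp : ∀ v, B (L v) (L v) ≤ 0 := fun v => by
    rcases eq_or_ne (L v) 0 with h | h
    · simp [h]
    · exact (hC _ (hLmem v) h).le
  let F : LinearMap.BilinForm ℚ V := B.compl₁₂ W W - B.compl₁₂ L L +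
    ∑ i, LinearMap.BilinForm.linMulLin (B (c i)) (B (c i))
  have hF : ∀ u v, F u v = B (W u) (W v) - B (L u) (L v) + ∑ i, B (c i) u * B (c i) v :=
    fun u v => by simp [F, LinearMap.sum_apply]
  have hFsymm : ∀ u v, F u v = F v u := fun u v => by
    simp only [hF, hB (W u), hB (L u), mul_comm]
  have hsum : ∀ v, 0 ≤ ∑ i, B (c i) v * B (c i) v := fun v =>
    Finset.sum_nonneg fun i _ => mul_self_nonneg _
  have hFpos : ∀ v, v ≠ 0 → 0 < F v v := by
    intro v hv
    have h1 := hWnn v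
    have h2 := hLnp v
    have h3 := hsum v
    rw [hF]
    by_contra! hle
    have hW0 : W v = 0 := by
      by_contra h
      linarith [hperp _ (fun i => hcW i v) h]
    have hL0 : L v = 0 := by
      by_contra h
      linarith [hC _ (hLmem v) h]
    have hx : ∀ i, B (c i) v = 0 := fun i => by
      have h0 : ∑ i, B (c i) v * B (c i) v = 0 := by linarith
      have := (Finset.sum_eq_zero_iff_of_nonneg fun i _ => mul_self_nonneg _).mp h0 i
        (Finset.mem_univ i)
      exact mul_self_eq_zero.mp this
    apply hv
    rw [hW v, hW0, hL0, hR, hL0]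
    simp [hx]
  obtain ⟨K, hK, hl⟩ := F.exists_sq_le_of_posDef hFsymm hFpos l
  obtain ⟨D, hD0, hD⟩ : ∃ D : ℚ, 0 ≤ D ∧ ∀ i, -d i ≤ D :=
    ⟨∑ i, -d i, Finset.sum_nonneg fun i _ => (neg_pos.mpr (hd i)).le, fun i =>
      Finset.single_le_sum (f := fun i => -d i) (fun i _ => (neg_pos.mpr (hd i)).le)
        (Finset.mem_univ i)⟩
  let E : ℚ := 1 + b * (D / ε) ^ 2
  have hE : 0 ≤ E := by positivity
  refine ⟨1 + K * E, by positivity, fun v hcone haway => ?_⟩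
  have hterm : ∀ i, 0 ≤ (d i)⁻¹ * B (c' i) v * B (c i) v := fun i => by
    have := mul_nonneg (neg_nonneg.mpr (inv_lt_zero.mpr (hd i)).le) (neg_nonneg.mpr (hcone i))
    linarith
  have hS := Finset.sum_nonneg fun i (_ : i ∈ Finset.univ) => hterm i
  have hBnn : 0 ≤ B v v := by
    rw [hBvv]
    linarith [hWnn v, hLnp v]
  refine ⟨hBnn, ?_⟩
  have hx : ∀ i, |B (c i) v| ≤ D / ε * B v v := fun i => by
    have h1 : (d i)⁻¹ * B (c' i) v * B (c i) v ≤ B v v := by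
      have := Finset.single_le_sum (fun i _ => hterm i) (Finset.mem_univ i)
      rw [hBvv]
      linarith [hWnn v, hLnp v]
    have h2 : |B (c' i) v| * |B (c i) v| ≤ D * B v v := by
      have h3 : |B (c' i) v| * |B (c i) v| =
          -d i * ((d i)⁻¹ * B (c' i) v * B (c i) v) := by
        rw [← abs_mul, mul_comm, abs_of_nonpos (by linarith [hcone i])]
        field_simp [hd0 i]
      rw [h3]
      exact mul_le_mul (hD i) h1 (hterm i) hD0
    have h4 : ε * |B (c i) v| ≤ D * B v v :=
      (mul_le_mul_of_nonneg_right (haway i) (abs_nonneg _)).trans h2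
    rw [div_mul_eq_mul_div, le_div_iff₀ hε]
    linarith
  have hxx : ∑ i, B (c i) v * B (c i) v ≤ b * (D / ε * B v v) ^ 2 := by
    have : ∀ i ∈ Finset.univ, B (c i) v * B (c i) v ≤ (D / ε * B v v) ^ 2 := fun i _ => by
      rw [← abs_mul_abs_self, ← sq]
      exact pow_le_pow_left₀ (abs_nonneg _) (hx i) 2
    simpa using Finset.sum_le_card_nsmul _ _ _ this
  have hFle : F v v ≤ E * (1 + B v v) ^ 2 := by
    have h1 : F v v ≤ B v v + b * (D / ε * B v v) ^ 2 := by
      have := hBvv v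
      rw [hF]
      linarith
    have h2 : 0 ≤ b * (D / ε) ^ 2 * (1 + 2 * B v v) := by positivity
    simp only [E]
    nlinarith [sq_nonneg (B v v)]
  refine abs_le.mpr (abs_le_of_sq_le_sq' ?_ (by positivity))
  have hKE : 0 ≤ K * E := by positivity
  calc l v ^ 2 ≤ K * F v v := hl v
    _ ≤ K * (E * (1 + B v v) ^ 2) := mul_le_mul_of_nonneg_left hFle hK
    _ = (K * E) * (1 + B v v) ^ 2 := by ring
    _ ≤ (1 + K * E) ^ 2 * (1 + B v v) ^ 2 := by
      gcongr
      nlinarith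
    _ = _ := by ring

theorem Summable.pi_prod_of_nonneg {ι α : Type*} [Fintype ι] {f : α → ℝ} (hf : Summable f)
    (hnn : ∀ a, 0 ≤ f a) : Summable fun g : ι → α => ∏ i, f (g i) := by
  classical
  refine summable_of_sum_le (c := ∏ _i : ι, ∑' a, f a)
    (fun g => Finset.prod_nonneg fun i _ => hnn _) fun s => ?_
  calc ∑ g ∈ s, ∏ i, f (g i)
      ≤ ∑ g ∈ Fintype.piFinset fun i => s.image (· i), ∏ i, f (g i) :=
        Finset.sum_le_sum_of_subset_of_nonneg
          (fun g hg => Fintype.mem_piFinset.mpr fun i => Finset.mem_image_of_mem _ hg)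
          fun g _ _ => Finset.prod_nonneg fun i _ => hnn _
    _ = ∏ i, ∑ a ∈ s.image (· i), f a := (Finset.prod_univ_sum _ _).symm
    _ ≤ ∏ _i : ι, ∑' a, f a :=
        Finset.prod_le_prod (fun i _ => Finset.sum_nonneg fun a _ => hnn a)
          fun i _ => hf.sum_le_tsum _ fun a _ => hnn a

theorem summable_int_one_add_abs_inv_sq : Summable fun m : ℤ => ((1 + |(m : ℝ)|) ^ 2)⁻¹ := by
  refine (Real.summable_one_div_int_pow.mpr one_lt_two).of_norm_bounded_eventually ?_
  rw [Filter.eventually_cofinite]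
  refine (Set.finite_singleton (0 : ℤ)).subset fun m hm => ?_
  by_contra h0
  apply hm
  have hm0 : (0 : ℝ) < |(m : ℝ)| := abs_pos.mpr (by exact_mod_cast h0)
  rw [Real.norm_of_nonneg (by positivity), one_div, ← sq_abs (m : ℝ)]
  gcongr
  linarith

theorem exists_one_add_pow_mul_exp_neg_le (N : ℕ) {a : ℝ} (ha : 0 < a) :
    ∃ C : ℝ, 0 ≤ C ∧ ∀ s : ℝ, 0 ≤ s → (1 + s) ^ N * Real.exp (-(a * s)) ≤ C := by
  refine ⟨N.factorial / a ^ N * Real.exp a, by positivity, fun s hs => ?_⟩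
  have h := Real.pow_div_factorial_le_exp (a * (1 + s)) (by positivity) N
  rw [div_le_iff₀ (by positivity), mul_pow] at h
  have hexp : Real.exp (-(a * s)) = Real.exp a / Real.exp (a * (1 + s)) := by
    rw [← Real.exp_sub]
    congr 1
    ring
  rw [hexp, mul_div_assoc', div_le_iff₀ (Real.exp_pos _), div_mul_eq_mul_div, div_mul_eq_mul_div,
    le_div_iff₀ (by positivity)]
  nlinarith [mul_le_mul_of_nonneg_right h (Real.exp_pos a).le]

/-- A nonvanishing rational affine form on a lattice is bounded away from zero. -/
theorem exists_pos_le_abs_affine {n : ℕ} (r : ℚ) (a : Fin n → ℚ) :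
    ∃ ε : ℚ, 0 < ε ∧ ∀ g : Fin n → ℤ, r + ∑ t, a t * g t ≠ 0 → ε ≤ |r + ∑ t, a t * g t| := by
  obtain ⟨D, hD⟩ := IsLocalization.exist_integer_multiples_of_finite (nonZeroDivisors ℤ)
    (fun o : Option (Fin n) => o.elim r a)
  choose z hz using hD
  have hD0 : ((D : ℤ) : ℚ) ≠ 0 := by exact_mod_cast nonZeroDivisors.coe_ne_zero D
  have hpos : 0 < |((D : ℤ) : ℚ)| := abs_pos.mpr hD0
  refine ⟨|((D : ℤ) : ℚ)|⁻¹, inv_pos.mpr hpos, fun g hg => ?_⟩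
  have hr : ((D : ℤ) : ℚ) * r = z none := by simpa using (hz none).symm
  have ha : ∀ t, ((D : ℤ) : ℚ) * a t = z (some t) := fun t => by simpa using (hz (some t)).symm
  have hint : ((D : ℤ) : ℚ) * (r + ∑ t, a t * g t)
      = ((z none + ∑ t, z (some t) * g t : ℤ) : ℚ) := by
    push_cast
    rw [mul_add, hr, Finset.mul_sum]
    simp_rw [← mul_assoc, ha]
  have hne : z none + ∑ t, z (some t) * g t ≠ 0 := fun h => by
    rw [h, Int.cast_zero] at hint
    exact mul_ne_zero hD0 hg hint
  rw [inv_le_iff_one_le_mul₀' hpos, ← abs_mul, hint]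
  exact_mod_cast Int.one_le_abs hne

/-- The pairing `intPair M` as a bilinear form. -/
def intPairForm {n : ℕ} (M : Matrix (Fin n) (Fin n) ℤ) : LinearMap.BilinForm ℚ (Fin n → ℚ) :=
  LinearMap.mk₂ ℚ (intPair M)
    (fun x y z => by simp [intPair, mul_add, add_mul, Finset.sum_add_distrib])
    (fun r x y => by
      simp only [intPair, Pi.smul_apply, smul_eq_mul, Finset.mul_sum]
      exact Finset.sum_congr rfl fun i _ => Finset.sum_congr rfl fun j _ => by ring)
    (fun x y z => by simp [intPair, mul_add, Finset.sum_add_distrib])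
    (fun r x y => by
      simp only [intPair, Pi.smul_apply, smul_eq_mul, Finset.mul_sum]
      exact Finset.sum_congr rfl fun i _ => Finset.sum_congr rfl fun j _ => by ring)

theorem intPairForm_apply {n : ℕ} (M : Matrix (Fin n) (Fin n) ℤ) (x y : Fin n → ℚ) :
    intPairForm M x y = intPair M x y := rfl

theorem intPair_comm {n : ℕ} {M : Matrix (Fin n) (Fin n) ℤ} (hM : M.IsSymm) (x y : Fin n → ℚ) :
    intPair M x y = intPair M y x := by
  unfold intPair
  rw [Finset.sum_comm]
  exact Finset.sum_congr rfl fun i _ => Finset.sum_congr rfl fun j _ => by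
    rw [hM.apply i j]
    ring

theorem abs_sgn_le_one (x : ℚ) : |sgn x| ≤ 1 := by
  unfold sgn
  split_ifs <;> simp

theorem mul_nonpos_of_sgn_ne {x y : ℚ} (h : sgn x ≠ sgn y) : x * y ≤ 0 := by
  by_contra! hpos
  apply h
  rcases mul_pos_iff.mp hpos with ⟨hx, hy⟩ | ⟨hx, hy⟩
  · simp [sgn, hx, hy]
  · simp [sgn, hx, hy, hx.not_gt, hy.not_gt]

namespace ThetaData

/-- The values `B(x, ν)`, `ν ∈ ν̄ + Γ`, are bounded away from zero if they do not vanish. -/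
theorem exists_pos_le_abs_intPair_nu (ξ : ThetaData) (x : Fin ξ.n → ℚ)
    (hx : ∀ g, intPair ξ.M x (ξ.nu g) ≠ 0) :
    ∃ ε : ℚ, 0 < ε ∧ ∀ g, ε ≤ |intPair ξ.M x (ξ.nu g)| := by
  obtain ⟨ε, hε, h⟩ := exists_pos_le_abs_affine (intPair ξ.M x ξ.nubar)
    fun t => ∑ i, (ξ.M i t : ℚ) * x i
  have heq : ∀ g, intPair ξ.M x (ξ.nu g) =
      intPair ξ.M x ξ.nubar + ∑ t, (∑ i, (ξ.M i t : ℚ) * x i) * g t := fun g => by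
    rw [← intPairForm_apply, nu, map_add, intPairForm_apply, intPairForm_apply]
    congr 1
    rw [intPair, Finset.sum_comm]
    exact Finset.sum_congr rfl fun t _ => (Finset.sum_mul _ _ _).symm
  refine ⟨ε, hε, fun g => ?_⟩
  have := hx g
  rw [heq] at this ⊢
  exact h g this

/-- The product of sign differences in the theta series. -/
def signFactor (ξ : ThetaData) (g : Fin ξ.n → ℤ) : ℚ :=
  ∏ i, (sgn (intPair ξ.M (ξ.c i) (ξ.nu g)) - sgn (intPair ξ.M (ξ.c' i) (ξ.nu g)))

theorem abs_signFactor_le (ξ : ThetaData) (g : Fin ξ.n → ℤ) : |ξ.signFactor g| ≤ 2 ^ ξ.b := by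
  rw [signFactor, Finset.abs_prod]
  refine (Finset.prod_le_prod (g := fun _ => 2) (fun i _ => abs_nonneg _) fun i _ => ?_).trans
    (by simp)
  have := abs_sub (sgn (intPair ξ.M (ξ.c i) (ξ.nu g))) (sgn (intPair ξ.M (ξ.c' i) (ξ.nu g)))
  linarith [abs_sgn_le_one (intPair ξ.M (ξ.c i) (ξ.nu g)),
    abs_sgn_le_one (intPair ξ.M (ξ.c' i) (ξ.nu g))]

/-- On the support of the theta series, `B(ν, ν) ≥ 0` and linear functionals of `ν` grow at most
linearly in `B(ν, ν)`. -/
theorem IsThetaData.exists_abs_le {ξ : ThetaData} (hξ : ξ.IsThetaData)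
    (l : (Fin ξ.n → ℚ) →ₗ[ℚ] ℚ) :
    ∃ K : ℚ, 0 ≤ K ∧ ∀ g, ξ.signFactor g ≠ 0 → 0 ≤ intPair ξ.M (ξ.nu g) (ξ.nu g) ∧
      |l (ξ.nu g)| ≤ K * (1 + intPair ξ.M (ξ.nu g) (ξ.nu g)) := by
  obtain ⟨hbn, hM, -, ⟨P, hPdim, hP⟩, hCdim, hC, hcross, hisotropic, hd, hnu⟩ := hξ
  choose ε hε hεle using fun i => ξ.exists_pos_le_abs_intPair_nu (ξ.c' i) (hnu i)
  obtain ⟨δ, hδ, hδε⟩ : ∃ δ : ℚ, 0 < δ ∧ ∀ i, δ ≤ ε i :=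
    ⟨(1 + ∑ i, (ε i)⁻¹)⁻¹, by
      have := Finset.sum_nonneg fun i (_ : i ∈ Finset.univ) => (inv_pos.mpr (hε i)).le
      positivity, fun i => by
      have := Finset.single_le_sum (fun i _ => (inv_pos.mpr (hε i)).le) (Finset.mem_univ i)
      exact inv_le_of_inv_le₀ (hε i) (by linarith)⟩
  obtain ⟨K, hK, h⟩ := (intPairForm ξ.M).exists_abs_le_on_cone (intPair_comm hM) ξ.c ξ.c' hC
    (fun w hw hw0 => (intPairForm ξ.M).apply_self_pos_of_orthogonal (intPair_comm hM) P
      (Submodule.span ℚ (Set.range ξ.c))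
      (by rw [hPdim, hCdim, Module.finrank_fin_fun]; omega) hP hC w
      (fun v hv => by
        have hle : Submodule.span ℚ (Set.range ξ.c) ≤ LinearMap.ker ((intPairForm ξ.M).flip w) :=
          Submodule.span_le.mpr (by rintro _ ⟨i, rfl⟩; exact hw i)
        exact hle hv) hw0)
    hcross hisotropic hd δ hδ l
  refine ⟨K, hK, fun g hg => h (ξ.nu g) (fun i => ?_) fun i => (hδε i).trans (hεle i g)⟩
  exact mul_nonpos_of_sgn_ne (sub_ne_zero.mp (Finset.prod_ne_zero_iff.mp hg i (Finset.mem_univ i)))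

theorem norm_term (ξ : ThetaData) (τ : ℂ) (g : Fin ξ.n → ℤ) :
    ‖ξ.term τ g‖ = |(ξ.signFactor g : ℝ)| * (∏ j, |(intPair ξ.M (ξ.alpha j) (ξ.nu g) : ℝ)|) *
      Real.exp (-(Real.pi * τ.im * (intPair ξ.M (ξ.nu g) (ξ.nu g) : ℝ))) := by
  have hq : ∀ q : ℚ, ‖(q : ℂ)‖ = |(q : ℝ)| := fun q => by
    rw [← Complex.ofReal_ratCast, Complex.norm_real, Real.norm_eq_abs]
  rw [term, norm_mul, Complex.norm_exp, hq, ← signFactor]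
  congr 1
  · push_cast
    rw [abs_mul, Finset.abs_prod]
  · congr 1
    set q := intPair ξ.M (ξ.nu g) (ξ.nu g)
    have : 2 * (Real.pi : ℂ) * Complex.I * ((q / 2 : ℚ) : ℂ) * τ =
        ((Real.pi * q : ℝ) : ℂ) * (Complex.I * τ) := by
      push_cast
      ring
    rw [this, Complex.re_ofReal_mul]
    simp
    ring

end ThetaData

/-- For theta data `ξ` and `τ` in the upper half plane, the family of
terms of the theta series `Θ_ξ(τ)` is absolutely summable; in particular `Θ_ξ(τ)`
converges absolutely. -/
theorem theta_series_absolutely_summable (ξ : ThetaData) (hξ : ξ.IsThetaData)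
    (τ : ℂ) (hτ : 0 < τ.im) :
    Summable fun g : Fin ξ.n → ℤ => ‖ξ.term τ g‖ := by
  obtain ⟨_, _, hnonneg⟩ := hξ.exists_abs_le 0
  replace hnonneg := fun g hg => (hnonneg g hg).1
  choose K hK0 hK using fun j => hξ.exists_abs_le (intPairForm ξ.M (ξ.alpha j))
  choose A hA0 hA using fun t => hξ.exists_abs_le (LinearMap.proj t)
  obtain ⟨C, hC0, hC⟩ := exists_one_add_pow_mul_exp_neg_le (ξ.k + 2 * ξ.n)
    (mul_pos Real.pi_pos hτ)
  let A' : Fin ξ.n → ℝ := fun t => 1 + A t + |(ξ.nubar t : ℝ)|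
  have hA'0 : ∀ t, 0 ≤ A' t := fun t => by
    have : (0 : ℝ) ≤ A t := by exact_mod_cast hA0 t
    positivity
  have hK0' : ∀ j, (0 : ℝ) ≤ K j := fun j => by exact_mod_cast hK0 j
  refine Summable.of_nonneg_of_le (fun _ => norm_nonneg _) (fun g => ?_)
    ((summable_int_one_add_abs_inv_sq.pi_prod_of_nonneg (ι := Fin ξ.n)
      fun m => by positivity).mul_left
        (2 ^ ξ.b * (∏ j, (K j : ℝ)) * C * ∏ t, A' t ^ 2))
  rw [ξ.norm_term]
  by_cases hg : ξ.signFactor g = 0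
  · rw [hg]
    simp only [Rat.cast_zero, abs_zero, zero_mul]
    have := Finset.prod_nonneg fun j (_ : j ∈ Finset.univ) => hK0' j
    positivity
  obtain ⟨s, hs⟩ : ∃ s : ℝ, s = (intPair ξ.M (ξ.nu g) (ξ.nu g) : ℝ) := ⟨_, rfl⟩
  rw [← hs]
  have hsign : |(ξ.signFactor g : ℝ)| ≤ 2 ^ ξ.b := by exact_mod_cast ξ.abs_signFactor_le g
  have hs0 : 0 ≤ s := by
    rw [hs]
    exact_mod_cast hnonneg g hg
  have halpha : ∏ j, |(intPair ξ.M (ξ.alpha j) (ξ.nu g) : ℝ)| ≤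
      (∏ j, (K j : ℝ)) * (1 + s) ^ ξ.k := by
    calc _ ≤ ∏ j, ((K j : ℝ) * (1 + s)) :=
          Finset.prod_le_prod (fun j _ => abs_nonneg _) fun j _ => by
            rw [hs]
            exact_mod_cast (hK j g hg).2
      _ = _ := by simp [Finset.prod_mul_distrib]
  have hcoord : ∀ t, 1 + |(g t : ℝ)| ≤ A' t * (1 + s) := fun t => by
    have h1 : |(ξ.nubar t : ℝ) + g t| ≤ A t * (1 + s) := by
      rw [hs]
      exact_mod_cast (hA t g hg).2
    have h2 : |(g t : ℝ)| ≤ |(ξ.nubar t : ℝ) + g t| + |(ξ.nubar t : ℝ)| := by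
      simpa using abs_sub ((ξ.nubar t : ℝ) + g t) (ξ.nubar t)
    simp only [A']
    nlinarith [mul_nonneg (abs_nonneg (ξ.nubar t : ℝ)) hs0]
  have hprod : 1 ≤ (1 + s) ^ (2 * ξ.n) *
      ((∏ t, A' t ^ 2) * ∏ t, ((1 + |(g t : ℝ)|) ^ 2)⁻¹) := by
    have h : ∏ t, (1 + |(g t : ℝ)|) ^ 2 ≤ (∏ t, A' t ^ 2) * (1 + s) ^ (2 * ξ.n) := by
      calc _ ≤ ∏ t, (A' t * (1 + s)) ^ 2 :=
            Finset.prod_le_prod (fun t _ => by positivity) fun t _ =>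
              pow_le_pow_left₀ (by positivity) (hcoord t) 2
        _ = _ := by simp [mul_pow, Finset.prod_mul_distrib, pow_mul]
    have hpos : 0 < ∏ t, (1 + |(g t : ℝ)|) ^ 2 := Finset.prod_pos fun t _ => by positivity
    rw [Finset.prod_inv_distrib, ← mul_assoc, ← div_eq_mul_inv, le_div_iff₀ hpos, one_mul]
    linarith
  have hKnn : 0 ≤ ∏ j, (K j : ℝ) := Finset.prod_nonneg fun j _ => hK0' j
  have hAnn : 0 ≤ ∏ t, A' t ^ 2 := Finset.prod_nonneg fun t _ => sq_nonneg _
  have hGnn : 0 ≤ ∏ t, ((1 + |(g t : ℝ)|) ^ 2)⁻¹ := Finset.prod_nonneg fun t _ => by positivity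
  generalize ∏ t, ((1 + |(g t : ℝ)|) ^ 2)⁻¹ = G at hprod hGnn ⊢
  generalize ∏ t, A' t ^ 2 = A₂ at hprod hAnn ⊢
  have hXnn : 0 ≤ ∏ j, |(intPair ξ.M (ξ.alpha j) (ξ.nu g) : ℝ)| :=
    Finset.prod_nonneg fun j _ => abs_nonneg _
  generalize ∏ j, |(intPair ξ.M (ξ.alpha j) (ξ.nu g) : ℝ)| = X at halpha hXnn ⊢
  generalize ∏ j, (K j : ℝ) = K₁ at halpha hKnn ⊢
  calc |(ξ.signFactor g : ℝ)| * X *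
        Real.exp (-(Real.pi * τ.im * s))
      ≤ 2 ^ ξ.b * (K₁ * (1 + s) ^ ξ.k) * Real.exp (-(Real.pi * τ.im * s)) := by
        gcongr
    _ ≤ 2 ^ ξ.b * (K₁ * (1 + s) ^ ξ.k) * Real.exp (-(Real.pi * τ.im * s)) *
          ((1 + s) ^ (2 * ξ.n) * (A₂ * G)) := le_mul_of_one_le_right (by positivity) hprod
    _ = 2 ^ ξ.b * K₁ *
          ((1 + s) ^ (ξ.k + 2 * ξ.n) * Real.exp (-(Real.pi * τ.im * s))) * (A₂ * G) := by
        rw [pow_add]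
        ring
    _ ≤ 2 ^ ξ.b * K₁ * C * (A₂ * G) := by
        gcongr
        exact hC s hs0
    _ = _ := by
        ring
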